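/- arXiv:1301.1445 — 2 statements merged into one kernel-verified Lean document; each statement's English description precedes it below -/
import Mathlib

section
/- For x = (x₁,…,x₈) ∈ ℝ⁸ set g₁(x) = |x₅| + 2|x₇x₈| + 2x₄ and g₂(x) = x₄ + x₆; let Ω₁ = {x : g₁(x) ≤ g₂(x), x₅ ≤ 0, x₇ + x₈x₄ = 0}, define g(x) = g₁(x) for x ∈ Ω₁ and g(x) = g₂(x) otherwise, and let Ω₂ = Ω₁ᶜ ∩ {x : x₇ + x₈x₄ = 0}, Ω₃ = {x : x₇ + x₈x₄ ≠ 0}, Ω₋ = {x : x₅ ≤ 0 and x₇ + x₈x₄ = 0}. Then the restrictions of g to Ω₂, to Ω₃ and to Ω₋ are Lipschitz on bounded sets; more precisely, for every M > 0 there is a constant C > 0 (depending only on M) such that whenever x and x̃ both lie in Ω₂, or both lie in Ω₃, or both lie in Ω₋, and |xᵢ| ≤ M, |x̃ᵢ| ≤ M for i = 4,…,8, then |g(x) − g(x̃)| ≤ C·( |x₄−x̃₄| + |x₅−x̃₅| + |x₆−x̃₆| + |x₇−x̃₇| + (|x₇| + |x̃₇|)·|x₈−x̃₈| ). -/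
/- We identify `x = (x₁,…,x₈) ∈ ℝ⁸` with `x : Fin 8 → ℝ`, so `xᵢ = x (i-1)`. -/

/-- `g₁(x) = |x₅| + 2|x₇x₈| + 2x₄`. -/
def g1 (x : Fin 8 → ℝ) : ℝ := |x 4| + 2 * |x 6 * x 7| + 2 * x 3

/-- `g₂(x) = x₄ + x₆`. -/
def g2 (x : Fin 8 → ℝ) : ℝ := x 3 + x 5

/-- `Ω₁ = {x : g₁(x) ≤ g₂(x), x₅ ≤ 0, x₇ + x₈x₄ = 0}`. -/
def Omega1 : Set (Fin 8 → ℝ) := {x | g1 x ≤ g2 x ∧ x 4 ≤ 0 ∧ x 6 + x 7 * x 3 = 0}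

open Classical in
/-- `g = g₁` on `Ω₁` and `g = g₂` otherwise. -/
noncomputable def gfun (x : Fin 8 → ℝ) : ℝ := if x ∈ Omega1 then g1 x else g2 x

/-- `Ω₂ = Ω₁ᶜ ∩ {x : x₇ + x₈x₄ = 0}`. -/
def Omega2 : Set (Fin 8 → ℝ) := Omega1ᶜ ∩ {x | x 6 + x 7 * x 3 = 0}

/-- `Ω₃ = {x : x₇ + x₈x₄ ≠ 0}`. -/
def Omega3 : Set (Fin 8 → ℝ) := {x | x 6 + x 7 * x 3 ≠ 0}

/-- `Ω₋ = {x : x₅ ≤ 0 and x₇ + x₈x₄ = 0}`. -/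
def OmegaMinus : Set (Fin 8 → ℝ) := {x | x 4 ≤ 0 ∧ x 6 + x 7 * x 3 = 0}

theorem g1_diff_le (M : ℝ) (hM : 0 < M) (x x' : Fin 8 → ℝ) (h7 : |x 7| ≤ M) :
    |g1 x - g1 x'| ≤ (2 + 2 * M) * (|x 3 - x' 3| + |x 4 - x' 4| + |x 5 - x' 5|
      + |x 6 - x' 6| + (|x 6| + |x' 6|) * |x 7 - x' 7|) := by
  have e : g1 x - g1 x' = (|x 4| - |x' 4|) + 2 * (|x 6 * x 7| - |x' 6 * x' 7|)
      + 2 * (x 3 - x' 3) := by unfold g1; ring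
  have a1 := abs_le.1 (abs_abs_sub_abs_le_abs_sub (x 4) (x' 4))
  have a2 := abs_le.1 (abs_abs_sub_abs_le_abs_sub (x 6 * x 7) (x' 6 * x' 7))
  have a3 : |x 6 * x 7 - x' 6 * x' 7| ≤ |x 6 - x' 6| * M + |x' 6| * |x 7 - x' 7| := by
    have : x 6 * x 7 - x' 6 * x' 7 = (x 6 - x' 6) * x 7 + x' 6 * (x 7 - x' 7) := by ring
    rw [this]
    refine (abs_add_le _ _).trans ?_
    rw [abs_mul, abs_mul]
    gcongr
  have a4 := abs_le.1 (le_refl |x 3 - x' 3|)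
  have p3 := abs_nonneg (x 3 - x' 3)
  have p4 := abs_nonneg (x 4 - x' 4)
  have p5 := abs_nonneg (x 5 - x' 5)
  have p6 := abs_nonneg (x 6 - x' 6)
  have q1 : 0 ≤ |x 6| * |x 7 - x' 7| := by positivity
  have q2 : 0 ≤ |x' 6| * |x 7 - x' 7| := by positivity
  have r3 := mul_nonneg hM.le p3
  have r4 := mul_nonneg hM.le p4
  have r5 := mul_nonneg hM.le p5
  have r6 := mul_nonneg hM.le p6
  have s1 := mul_nonneg hM.le q1
  have s2 := mul_nonneg hM.le q2
  rw [e, abs_le]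
  constructor <;> nlinarith

theorem g2_diff_le (M : ℝ) (hM : 0 < M) (x x' : Fin 8 → ℝ) :
    |g2 x - g2 x'| ≤ (2 + 2 * M) * (|x 3 - x' 3| + |x 4 - x' 4| + |x 5 - x' 5|
      + |x 6 - x' 6| + (|x 6| + |x' 6|) * |x 7 - x' 7|) := by
  have e : g2 x - g2 x' = (x 3 - x' 3) + (x 5 - x' 5) := by unfold g2; ring
  rw [e]
  refine (abs_add_le _ _).trans ?_
  have q : 0 ≤ |x 4 - x' 4| + |x 6 - x' 6| + (|x 6| + |x' 6|) * |x 7 - x' 7| := by positivity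
  have p3 := abs_nonneg (x 3 - x' 3)
  have p5 := abs_nonneg (x 5 - x' 5)
  have r := mul_nonneg hM.le q
  have r3 := mul_nonneg hM.le p3
  have r5 := mul_nonneg hM.le p5
  nlinarith

theorem gfun_eq_min (x : Fin 8 → ℝ) (hx : x ∈ OmegaMinus) : gfun x = min (g1 x) (g2 x) := by
  unfold gfun
  split_ifs with h
  · exact (min_eq_left h.1).symm
  · refine (min_eq_right ?_).symm
    by_contra hc
    exact h ⟨(not_le.1 hc).le, hx.1, hx.2⟩

theorem gfun_eq_g2 (x : Fin 8 → ℝ) (hx : x ∉ Omega1) : gfun x = g2 x := by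
  unfold gfun
  exact if_neg hx

/-- The restrictions of `g` to `Ω₂`, `Ω₃` and `Ω₋` are Lipschitz on bounded sets. -/
theorem g_lipschitz_on_bounded_sets :
    ∀ M : ℝ, 0 < M → ∃ C : ℝ, 0 < C ∧
    ∀ x x' : Fin 8 → ℝ,
    ((x ∈ Omega2 ∧ x' ∈ Omega2) ∨ (x ∈ Omega3 ∧ x' ∈ Omega3) ∨
      (x ∈ OmegaMinus ∧ x' ∈ OmegaMinus)) →
    (∀ i : Fin 8, 3 ≤ (i : ℕ) → |x i| ≤ M ∧ |x' i| ≤ M) →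
    |gfun x - gfun x'| ≤ C * (|x 3 - x' 3| + |x 4 - x' 4| + |x 5 - x' 5|
      + |x 6 - x' 6| + (|x 6| + |x' 6|) * |x 7 - x' 7|) := by
  intro M hM
  refine ⟨2 + 2 * M, by positivity, ?_⟩
  intro x x' h hb
  rcases h with ⟨h, h'⟩ | ⟨h, h'⟩ | ⟨h, h'⟩
  · rw [gfun_eq_g2 x h.1, gfun_eq_g2 x' h'.1]
    exact g2_diff_le M hM x x'
  · rw [gfun_eq_g2 x (fun k => h k.2.2), gfun_eq_g2 x' (fun k => h' k.2.2)]
    exact g2_diff_le M hM x x'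
  · rw [gfun_eq_min x h, gfun_eq_min x' h']
    exact (abs_min_sub_min_le_max _ _ _ _).trans
      (max_le (g1_diff_le M hM x x' (hb 7 (by decide)).1) (g2_diff_le M hM x x'))
end

section
/- Let y : ℝ → ℝ be a nondecreasing Lipschitz function, let C ≥ 0, and let g : ℝ → [0,∞) be a Lebesgue-integrable function such that g(ξ)² ≤ C·y'(ξ) for almost every ξ ∈ ℝ (where y' denotes the almost-everywhere defined derivative of y). Then the pushforward under y of the measure with density g with respect to Lebesgue measure (that is, the measure E ↦ ∫_{y⁻¹(E)} g dλ) is absolutely continuous with respect to Lebesgue measure. -/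
open MeasureTheory

/-- Absolute continuity of the pushforward density: if `y` is nondecreasing and
Lipschitz, `g ≥ 0` is integrable and `g² ≤ C·y'` almost everywhere, then the
pushforward under `y` of the measure with density `g` is absolutely continuous with
respect to Lebesgue measure. -/
theorem pushforward_density_absolutely_continuous
    (y : ℝ → ℝ) (hmono : Monotone y) (L : NNReal) (hLip : LipschitzWith L y)
    (C : ℝ) (hC : 0 ≤ C) (g : ℝ → ℝ)
    (hg : Integrable g) (hg0 : ∀ ξ, 0 ≤ g ξ)
    (hbound : ∀ᵐ ξ ∂volume, g ξ ^ 2 ≤ C * deriv y ξ) :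
    Measure.map y (volume.withDensity fun ξ => ENNReal.ofReal (g ξ)) ≪
      (volume : Measure ℝ) := by
  refine Measure.AbsolutelyContinuous.mk fun E hE hE0 => ?_
  have hym : Measurable y := hmono.measurable
  rw [Measure.map_apply hym hE, withDensity_apply _ (hym hE)]
  have hdiff : ∀ᵐ ξ, DifferentiableAt ℝ y ξ := hmono.ae_differentiableAt
  set D : Set ℝ := {ξ | DifferentiableAt ℝ y ξ} with hD
  have hDm : MeasurableSet D := measurableSet_of_differentiableAt ℝ y
  have hsm : MeasurableSet (y ⁻¹' E ∩ D) := (hym hE).inter hDm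
  have h1 : (∫⁻ x in y ⁻¹' E ∩ D, ENNReal.ofReal (deriv y x)) = 0 := by
    rw [lintegral_deriv_eq_volume_image_of_monotoneOn hsm
      (fun x hx => (DifferentiableAt.hasDerivAt hx.2).hasDerivWithinAt) (hmono.monotoneOn _)]
    refine measure_mono_null ?_ hE0
    rintro _ ⟨x, hx, rfl⟩
    exact hx.1
  rw [lintegral_eq_zero_iff (measurable_deriv y).ennreal_ofReal,
    Filter.EventuallyEq, ae_restrict_iff' hsm] at h1
  rw [setLIntegral_congr_fun_ae (g := fun _ => 0) (hym hE)]
  · simp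
  filter_upwards [h1, hdiff, hbound] with x hx hd hb hxE
  have h2 : deriv y x ≤ 0 := by simpa using hx ⟨hxE, hd⟩
  have h3 : g x ^ 2 ≤ 0 := hb.trans (mul_nonpos_of_nonneg_of_nonpos hC h2)
  have h4 : g x = 0 := by
    have := hg0 x
    nlinarith
  simp [h4]
end
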